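/- Let a ∈ ℤ³ be a nonzero vector. Then there exist linearly independent vectors x₁, x₂ ∈ ℤ³ with ⟨a,x₁⟩ = ⟨a,x₂⟩ = 0 and ‖x₁‖_∞ · ‖x₂‖_∞ ≤ (4/3) · ‖a‖_∞. -/

import Mathlib

open scoped Matrix

/-- Every integer vector in `ℤ³` is a cross product of two integer vectors. -/
theorem exists_crossProduct_eq (a : Fin 3 → ℤ) : ∃ u v : Fin 3 → ℤ, u ⨯₃ v = a := by
  obtain ⟨g, b, c, x, y, h₀, h₁, hxy⟩ :
      ∃ g b c x y : ℤ, a 0 = g * b ∧ a 1 = g * c ∧ x * b + y * c = 1 := by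
    by_cases hg : Int.gcd (a 0) (a 1) = 0
    · obtain ⟨h₀, h₁⟩ := Int.gcd_eq_zero_iff.mp hg
      exact ⟨0, 1, 0, 1, 0, by simp [h₀], by simp [h₁], by simp⟩
    · obtain ⟨b, hb⟩ := Int.gcd_dvd_left (a 0) (a 1)
      obtain ⟨c, hc⟩ := Int.gcd_dvd_right (a 0) (a 1)
      refine ⟨Int.gcd (a 0) (a 1), b, c, Int.gcdA (a 0) (a 1), Int.gcdB (a 0) (a 1), hb, hc, ?_⟩
      have hbez := Int.gcd_eq_gcd_ab (a 0) (a 1)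
      have hg' : (Int.gcd (a 0) (a 1) : ℤ) ≠ 0 := by exact_mod_cast hg
      apply mul_left_cancel₀ hg'
      linear_combination -hbez - Int.gcdA (a 0) (a 1) * hb - Int.gcdB (a 0) (a 1) * hc
  refine ⟨![c, -b, 0], ![a 2 * x, a 2 * y, -g], ?_⟩
  ext i
  fin_cases i
  · simp [cross_apply, h₀, mul_comm]
  · simp [cross_apply, h₁, mul_comm]
  · simp [cross_apply]
    linear_combination a 2 * hxy

/-- A nonzero cross product certifies linear independence over `ℤ`. -/
theorem linearIndependent_of_crossProduct_ne_zero {u v : Fin 3 → ℤ} (h : u ⨯₃ v ≠ 0) :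
    LinearIndependent ℤ ![u, v] := by
  rw [LinearIndependent.pair_iff]
  intro s t hst
  have hs : s • (u ⨯₃ v) = 0 := by
    have := congrArg (fun w => w ⨯₃ v) hst
    simpa [cross_self, -zsmul_eq_mul, -smul_eq_mul] using this
  have ht : t • (u ⨯₃ v) = 0 := by
    have := congrArg (fun w => u ⨯₃ w) hst
    simpa [cross_self, -zsmul_eq_mul, -smul_eq_mul] using this
  exact ⟨(smul_eq_zero.mp hs).resolve_right h, (smul_eq_zero.mp ht).resolve_right h⟩

/-- Three products whose factors pair up as `x` and `1 - x` cannot all exceed `1 / 4`. -/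
theorem not_all_quarter_lt {p q r : ℝ} (hp : 0 ≤ p) (hq : 0 ≤ q) (hp1 : p ≤ 1)
    (hq1 : q ≤ 1) (hr : 0 ≤ r) (hr1 : r ≤ 1) (h₁ : 1 / 4 < (1 - p) * (1 - q))
    (h₂ : 1 / 4 < p * r) (h₃ : 1 / 4 < q * (1 - r)) : False := by
  have hx (x : ℝ) : x * (1 - x) ≤ 1 / 4 := by nlinarith [sq_nonneg (x - 1 / 2)]
  have hx0 {x : ℝ} (h0 : 0 ≤ x) (h1 : x ≤ 1) : 0 ≤ x * (1 - x) :=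
    mul_nonneg h0 (by linarith)
  have hlow : 1 / 4 * (1 / 4) * (1 / 4) < (1 - p) * (1 - q) * (p * r) * (q * (1 - r)) := by
    gcongr
  have hup : p * (1 - p) * (q * (1 - q)) * (r * (1 - r)) ≤ 1 / 4 * (1 / 4) * (1 / 4) := by
    have := hx0 hp hp1
    have := hx0 hq hq1
    have := hx0 hr hr1
    gcongr <;> exact hx _
  linarith

/-- Coordinate form of the minor bound, for the vectors `(p, -q, s)` and `(t, x, r)`. -/
theorem mul_le_of_minors_le {p q r s t x m : ℝ} (hp : 0 ≤ p) (hps : p ≤ s) (hq : 0 ≤ q)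
    (hqs : q ≤ s) (hst : s ≤ t) (hrt : r ≤ t) (hx : t ≤ x + q)
    (h₁ : p * x + t * q ≤ m) (h₂ : s * t - p * r ≤ m) (h₃ : q * r + s * x ≤ m) :
    3 / 4 * (s * t) ≤ m := by
  have hs : 0 ≤ s := hp.trans hps
  have ht : 0 ≤ t := hs.trans hst
  rcases hs.eq_or_lt with rfl | hs'
  · have : p = 0 := le_antisymm hps hp
    subst this
    nlinarith
  have ht' : 0 < t := hs'.trans_le hst
  rcases le_total r 0 with hr | hr
  · nlinarith [mul_nonneg hs ht]
  by_contra! hm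
  obtain ⟨p, rfl⟩ : ∃ p', p = s * p' := ⟨p / s, by field_simp⟩
  obtain ⟨q, rfl⟩ : ∃ q', q = s * q' := ⟨q / s, by field_simp⟩
  obtain ⟨r, rfl⟩ : ∃ r', r = t * r' := ⟨r / t, by field_simp⟩
  have hp0 : 0 ≤ p := nonneg_of_mul_nonneg_right hp hs'
  have hq0 : 0 ≤ q := nonneg_of_mul_nonneg_right hq hs'
  have hr0 : 0 ≤ r := nonneg_of_mul_nonneg_right hr ht'
  have hp1 : p ≤ 1 := by nlinarith
  have hq1 : q ≤ 1 := by nlinarith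
  have hr1 : r ≤ 1 := by nlinarith
  have hx' : t * (1 - q) ≤ x := by nlinarith
  have hpos : 0 < s * t := mul_pos hs' ht'
  have hpx := mul_le_mul_of_nonneg_left hx' hp
  have hsx := mul_le_mul_of_nonneg_left hx' hs
  refine not_all_quarter_lt hp0 hq0 hp1 hq1 hr0 hr1 ?_ ?_ ?_ <;>
    refine lt_of_mul_lt_mul_left ?_ hpos.le <;> linarith

theorem exists_abs_eq_norm {ι : Type*} [Fintype ι] [Nonempty ι] (u : ι → ℝ) :
    ∃ i, |u i| = ‖u‖ := by
  obtain ⟨i, hi⟩ := Finite.exists_max fun i => |u i|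
  exact ⟨i, le_antisymm (norm_le_pi_norm u i)
    ((pi_norm_le_iff_of_nonneg (abs_nonneg _)).mpr hi)⟩

theorem abs_minor_le_norm_crossProduct (u v : Fin 3 → ℝ) (i j : Fin 3) :
    |u i * v j - u j * v i| ≤ ‖u ⨯₃ v‖ := by
  have h₀ := norm_le_pi_norm (u ⨯₃ v) 0
  have h₁ := norm_le_pi_norm (u ⨯₃ v) 1
  have h₂ := norm_le_pi_norm (u ⨯₃ v) 2
  simp only [cross_apply, Real.norm_eq_abs, Matrix.cons_val] at h₀ h₁ h₂
  rw [← cross_apply] at h₀ h₁ h₂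
  rw [abs_le] at *
  fin_cases i <;> fin_cases j <;> simp <;> constructor <;> linarith

/-- The minor bound when a maximal coordinate of `v` is positive and the corresponding
coordinate of `u` is nonnegative. -/
theorem norm_mul_norm_le_of_nonneg {u v : Fin 3 → ℝ} (huv : ‖u‖ ≤ ‖v‖)
    (hsub : ‖v‖ ≤ ‖v - u‖) {i : Fin 3} (hv : v i = ‖v‖) (hu : 0 ≤ u i) :
    3 / 4 * (‖u‖ * ‖v‖) ≤ ‖u ⨯₃ v‖ := by
  obtain ⟨k, hk⟩ := exists_abs_eq_norm u
  obtain ⟨j, hj⟩ := exists_abs_eq_norm (v - u)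
  have hM := abs_minor_le_norm_crossProduct u v
  have hU : ∀ l, |u l| ≤ ‖u‖ := norm_le_pi_norm u
  have hV : ∀ l, |v l| ≤ ‖v‖ := norm_le_pi_norm v
  have hs := norm_nonneg u
  have ht := norm_nonneg v
  generalize ‖u ⨯₃ v‖ = m at *
  generalize ‖v - u‖ = w at *
  generalize ‖u‖ = s at *
  generalize ‖v‖ = t at *
  have hst := mul_nonneg hs ht
  rcases hu.eq_or_lt with hu0 | hu0
  · have := hM i k
    rw [← hu0, hv, zero_mul, zero_sub, abs_neg, abs_mul, hk, abs_of_nonneg ht] at this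
    linarith
  have hij : i ≠ j := by
    rintro rfl
    have := (abs_le.mp (hU i)).2
    rw [Pi.sub_apply, hv, abs_of_nonneg (by linarith)] at hj
    linarith
  -- Multiplying the `j`-th and `k`-th coordinates by signs normalizes the configuration.
  have hsign (e : ℝ) (he : e = 1 ∨ e = -1) (he' : t ≤ e * (v j - u j)) :
      3 / 4 * (s * t) ≤ m := by
    have hij' := abs_le.mp (hM i j)
    have hjb := abs_le.mp (hU j)
    have hvj := abs_le.mp (hV j)
    have hib := (abs_le.mp (hU i)).2
    rw [hv] at hij'
    have hq0 : 0 ≤ -(e * u j) := by rcases he with rfl | rfl <;> linarith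
    have hqs : -(e * u j) ≤ s := by rcases he with rfl | rfl <;> linarith
    have hminor : u i * (e * v j) + t * -(e * u j) ≤ m := by
      rcases he with rfl | rfl <;> linarith
    by_cases hki : k = i
    · subst hki
      rw [abs_of_pos hu0] at hk
      rw [hk] at hminor
      nlinarith
    by_cases hkj : k = j
    · subst hkj
      have hq : -(e * u k) = s := by
        rw [← hk, ← abs_of_nonneg hq0]
        rcases he with rfl | rfl <;> simp
      rw [hq] at hminor
      have : 0 ≤ e * v k := by linarith
      nlinarith [mul_nonneg hu this]
    have hik' := abs_le.mp (hM i k)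
    have hjk' := abs_le.mp (hM j k)
    have hvk := abs_le.mp (hV k)
    rw [hv] at hik'
    rcases abs_eq hs |>.mp hk with hk | hk <;> rw [hk] at hik' hjk'
    · refine mul_le_of_minors_le (r := v k) hu hib hq0 hqs huv (by linarith)
        (by linarith) hminor (by linarith) ?_
      rcases he with rfl | rfl <;> linarith
    · refine mul_le_of_minors_le (r := -v k) hu hib hq0 hqs huv (by linarith)
        (by linarith) hminor (by linarith) ?_
      rcases he with rfl | rfl <;> linarith
  rw [Pi.sub_apply] at hj
  rcases le_abs'.mp (hj ▸ hsub) with h | h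
  · exact hsign (-1) (Or.inr rfl) (by linarith)
  · exact hsign 1 (Or.inl rfl) (by linarith)

/-- Reduced pairs in `ℝ³` with the maximum norm span parallelograms with a large minor. -/
theorem norm_mul_norm_le_norm_crossProduct {u v : Fin 3 → ℝ} (huv : ‖u‖ ≤ ‖v‖)
    (hsub : ‖v‖ ≤ ‖v - u‖) (hadd : ‖v‖ ≤ ‖v + u‖) :
    3 / 4 * (‖u‖ * ‖v‖) ≤ ‖u ⨯₃ v‖ := by
  obtain ⟨i, hi⟩ := exists_abs_eq_norm v
  wlog hv : v i = ‖v‖ generalizing v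
  · have hneg : -v i = ‖v‖ := by
      rcases abs_choice (v i) with h | h
      · exact absurd (h.symm.trans hi) hv
      · exact h.symm.trans hi
    have := this (v := -v) (by simpa) (by rw [← neg_add', norm_neg, norm_neg]; exact hadd)
      (by rw [neg_add_eq_sub, norm_sub_rev, norm_neg]; exact hsub) (by simpa) (by simpa)
    rwa [map_neg, norm_neg, norm_neg] at this
  rcases le_total 0 (u i) with hu | hu
  · exact norm_mul_norm_le_of_nonneg huv hsub hv hu
  · have := norm_mul_norm_le_of_nonneg (u := -u) (v := v) (i := i) (by simpa)
      (by simpa using hadd) hv (by simpa)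
    rwa [map_neg, LinearMap.neg_apply, norm_neg, norm_neg] at this

theorem natCast_floor_norm {ι : Type*} [Fintype ι] [Nonempty ι] (u : ι → ℤ) :
    (⌊‖fun i => (u i : ℝ)‖⌋₊ : ℝ) = ‖fun i => (u i : ℝ)‖ := by
  obtain ⟨i, hi⟩ := exists_abs_eq_norm fun i => (u i : ℝ)
  have : ‖fun i => (u i : ℝ)‖ = ((u i).natAbs : ℝ) := by
    rw [← hi, Nat.cast_natAbs, Int.cast_abs]
  rw [this, Nat.floor_natCast]

/-- Every integer vector is the cross product of a reduced pair of integer vectors. -/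
theorem exists_reduced_crossProduct_eq (a : Fin 3 → ℤ) :
    ∃ u v : Fin 3 → ℤ, u ⨯₃ v = a ∧
      ‖fun i => (u i : ℝ)‖ ≤ ‖fun i => (v i : ℝ)‖ ∧
      ‖fun i => (v i : ℝ)‖ ≤ ‖fun i => ((v - u) i : ℝ)‖ ∧
      ‖fun i => (v i : ℝ)‖ ≤ ‖fun i => ((v + u) i : ℝ)‖ := by
  let N (u : Fin 3 → ℤ) : ℝ := ‖fun i => (u i : ℝ)‖
  let S : Set ((Fin 3 → ℤ) × (Fin 3 → ℤ)) := {p | p.1 ⨯₃ p.2 = a}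
  have hS : S.Nonempty := by
    obtain ⟨u, v, h⟩ := exists_crossProduct_eq a
    exact ⟨(u, v), h⟩
  let f (p : (Fin 3 → ℤ) × (Fin 3 → ℤ)) : ℕ := ⌊N p.1⌋₊ + ⌊N p.2⌋₊
  obtain ⟨⟨u, v⟩, huv : u ⨯₃ v = a, hmin⟩ :=
    WellFounded.has_min (InvImage.wf f Nat.lt_wfRel.wf) S hS
  have hle (u' v' : Fin 3 → ℤ) (h : u' ⨯₃ v' = a) : N u + N v ≤ N u' + N v' := by
    have h' : f (u, v) ≤ f (u', v') := not_lt.mp (hmin (u', v') h)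
    have h'' : ((f (u, v) : ℕ) : ℝ) ≤ f (u', v') := by exact_mod_cast h'
    simpa only [f, N, Nat.cast_add, natCast_floor_norm] using h''
  have hneg (w : Fin 3 → ℤ) : N (-w) = N w := by
    refine Eq.trans ?_ (norm_neg fun i => (w i : ℝ))
    simp only [N]
    congr 1
    ext i
    simp
  have h₁ := hle u (v - u) (by simp [cross_self, huv])
  have h₂ := hle u (v + u) (by simp [cross_self, huv])
  have h₃ := hle (u - v) v (by simp [cross_self, huv])
  have h₄ := hle (u + v) v (by simp [cross_self, huv])
  rcases le_total (N u) (N v) with h | h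
  · exact ⟨u, v, huv, h, by linarith, by linarith⟩
  · refine ⟨-v, u, by simp [← huv], (hneg v).trans_le h, ?_, ?_⟩
    · rw [sub_neg_eq_add]
      linarith
    · rw [← sub_eq_add_neg]
      linarith

/-- For every nonzero `a ∈ ℤ³` there exist linearly independent
`x₁, x₂ ∈ ℤ³` orthogonal to `a` with `‖x₁‖_∞ · ‖x₂‖_∞ ≤ (4/3) · ‖a‖_∞`. -/
theorem stmt_0 (a : Fin 3 → ℤ) (ha : a ≠ 0) :
    ∃ x₁ x₂ : Fin 3 → ℤ, LinearIndependent ℤ ![x₁, x₂] ∧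
      (∑ i, a i * x₁ i) = 0 ∧ (∑ i, a i * x₂ i) = 0 ∧
      ‖(fun i => (x₁ i : ℝ) : Fin 3 → ℝ)‖ * ‖(fun i => (x₂ i : ℝ) : Fin 3 → ℝ)‖ ≤
        (4 / 3) * ‖(fun i => (a i : ℝ) : Fin 3 → ℝ)‖ := by
  obtain ⟨u, v, rfl, huv, hsub, hadd⟩ := exists_reduced_crossProduct_eq a
  refine ⟨u, v, linearIndependent_of_crossProduct_ne_zero ha, ?_, ?_, ?_⟩
  · simpa [dotProduct, mul_comm] using dot_self_cross u v
  · simpa [dotProduct, mul_comm] using dot_cross_self u v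
  · have hcast : (fun i => ((u ⨯₃ v) i : ℝ)) =
        (fun i => (u i : ℝ)) ⨯₃ (fun i => (v i : ℝ)) := by
      ext i
      fin_cases i <;> simp [cross_apply]
    have h := norm_mul_norm_le_norm_crossProduct huv
      (hsub.trans_eq (by congr 1; ext i; simp)) (hadd.trans_eq (by congr 1; ext i; simp))
    rw [hcast]
    linarith
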